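/- arXiv:2510.16221 — 6 statements merged into one kernel-verified Lean document; each statement's English description precedes it below -/
import Mathlib

section
/- Let P be a finite set of job types, c : P → ℕ durations with 1 ≤ c(p) ≤ C_u for all p ∈ P, and r : P → ℝ rewards with r(p) ≥ 0. Let 𝒜 be a nonempty finite family of subsets of P and set Q = max_{A ∈ 𝒜} ∑_{p ∈ A} r(p)/c(p). Let J be a finite set of jobs, each job j having a type p(j) ∈ P and an integer start time s(j) ∈ ℤ, where job j executes during the time steps s(j), s(j)+1, …, s(j)+c(p(j))−1. Assume that (i) for every time step u ∈ ℤ, the set B(u) = { p(j) : j ∈ J, s(j) ≤ u ≤ s(j)+c(p(j))−1 } of types executing at time u belongs to 𝒜, and (ii) no two distinct jobs of the same type have overlapping execution intervals. Then for every integer T ≥ 1, the total reward of jobs completed within the window [1,T], namely ∑_{j ∈ J, 1 ≤ s(j)+c(p(j))−1 ≤ T} r(p(j)), is at most (T + C_u) · Q. -/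
open Finset

/-- Deterministic per-round reward upper bound: the total reward of jobs completed within
the window `[1, T]` by a schedule whose set of simultaneously executing job types is always
feasible is at most `(T + C_u) * Q`, where `Q` is the best per-round reward over feasible
type sets. -/
theorem stmt0 {P J : Type*} [Fintype P] [Fintype J] [DecidableEq P]
    (Cu : ℕ) (c : P → ℕ) (hc : ∀ p, 1 ≤ c p ∧ c p ≤ Cu)
    (r : P → ℝ) (hr : ∀ p, 0 ≤ r p)
    (𝒜 : Finset (Finset P)) (h𝒜 : 𝒜.Nonempty)
    (typ : J → P) (s : J → ℤ)
    (hfeas : ∀ u : ℤ,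
      ((Finset.univ : Finset J).filter
          (fun j => s j ≤ u ∧ u ≤ s j + (c (typ j) : ℤ) - 1)).image typ ∈ 𝒜)
    (hnooverlap : ∀ j k : J, j ≠ k → typ j = typ k → ∀ u : ℤ,
      s j ≤ u → u ≤ s j + (c (typ j) : ℤ) - 1 →
      s k ≤ u → u ≤ s k + (c (typ k) : ℤ) - 1 → False)
    (T : ℤ) (hT : 1 ≤ T) :
    ∑ j ∈ (Finset.univ : Finset J).filter
        (fun j => 1 ≤ s j + (c (typ j) : ℤ) - 1 ∧ s j + (c (typ j) : ℤ) - 1 ≤ T),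
        r (typ j)
      ≤ ((T : ℝ) + (Cu : ℝ)) * 𝒜.sup' h𝒜 (fun A => ∑ p ∈ A, r p / (c p : ℝ)) := by
  set Q := 𝒜.sup' h𝒜 (fun A => ∑ p ∈ A, r p / (c p : ℝ)) with hQ
  have hu : ∀ u : ℤ, ∑ j ∈ (Finset.univ : Finset J).filter
      (fun j => s j ≤ u ∧ u ≤ s j + (c (typ j) : ℤ) - 1), r (typ j) / (c (typ j) : ℝ) ≤ Q := by
    intro u
    have h1 := Finset.le_sup' (fun A => ∑ p ∈ A, r p / (c p : ℝ)) (hfeas u)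
    refine le_trans (le_of_eq ?_) h1
    show _ = ∑ p ∈ _, r p / (c p : ℝ)
    rw [Finset.sum_image]
    intro j hj k hk hjk
    simp only [Finset.coe_filter, Finset.mem_univ, true_and, Set.mem_setOf_eq] at hj hk
    by_contra hne
    exact hnooverlap j k hne hjk u hj.1 hj.2 hk.1 hk.2
  have hj : ∀ j ∈ (Finset.univ : Finset J).filter
        (fun j => 1 ≤ s j + (c (typ j) : ℤ) - 1 ∧ s j + (c (typ j) : ℤ) - 1 ≤ T),
      r (typ j) = ∑ u ∈ Finset.Icc (1 - (Cu : ℤ)) T,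
        if s j ≤ u ∧ u ≤ s j + (c (typ j) : ℤ) - 1 then r (typ j) / (c (typ j) : ℝ) else 0 := by
    intro j hj
    simp only [Finset.mem_filter, Finset.mem_univ, true_and] at hj
    obtain ⟨h1, h2⟩ := hc (typ j)
    rw [← Finset.sum_filter]
    have he : (Finset.Icc (1 - (Cu : ℤ)) T).filter
        (fun u => s j ≤ u ∧ u ≤ s j + (c (typ j) : ℤ) - 1)
        = Finset.Icc (s j) (s j + (c (typ j) : ℤ) - 1) := by
      ext u
      simp only [Finset.mem_filter, Finset.mem_Icc]
      omega
    have hcard : (s j + (c (typ j) : ℤ) - 1 + 1 - s j).toNat = c (typ j) := by omega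
    have hpos : (c (typ j) : ℝ) ≠ 0 := by
      have : c (typ j) ≠ 0 := by omega
      exact_mod_cast this
    rw [he, Finset.sum_const, Int.card_Icc, hcard, nsmul_eq_mul]
    field_simp
  rw [Finset.sum_congr rfl hj, Finset.sum_comm]
  have hb : ∀ u ∈ Finset.Icc (1 - (Cu : ℤ)) T,
      ∑ j ∈ (Finset.univ : Finset J).filter
        (fun j => 1 ≤ s j + (c (typ j) : ℤ) - 1 ∧ s j + (c (typ j) : ℤ) - 1 ≤ T),
        (if s j ≤ u ∧ u ≤ s j + (c (typ j) : ℤ) - 1 then r (typ j) / (c (typ j) : ℝ) else 0)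
      ≤ Q := by
    intro u _
    refine le_trans ?_ (hu u)
    rw [Finset.sum_filter (fun j => s j ≤ u ∧ u ≤ s j + (c (typ j) : ℤ) - 1)]
    refine Finset.sum_le_sum_of_subset_of_nonneg (Finset.filter_subset _ _) ?_
    intro j _ _
    have := hr (typ j)
    split_ifs
    · positivity
    · exact le_rfl
  refine (Finset.sum_le_card_nsmul _ _ _ hb).trans (le_of_eq ?_)
  rw [Int.card_Icc, nsmul_eq_mul]
  congr 1
  have h3 : (((T + 1 - (1 - (Cu : ℤ))).toNat : ℕ) : ℤ) = T + Cu := by omega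
  exact_mod_cast h3
end

section
/- Let X_1, X_2, … be i.i.d. real-valued random variables taking values in [0,1] almost surely, with mean μ, and let X̄_n = (1/n)∑_{k=1}^n X_k be the empirical mean of the first n samples. Then for every integer t ≥ 1, P( there exists n with 1 ≤ n ≤ t such that |X̄_n − μ| ≥ √(1.5 · ln t / n) ) ≤ 2 / t². -/
open MeasureTheory ProbabilityTheory Finset

theorem one_side_aux {Ω : Type*} [MeasurableSpace Ω] (μ : Measure Ω) [IsProbabilityMeasure μ]
    (Y : ℕ → Ω → ℝ) (hindep : iIndepFun Y μ)
    (hsub : ∀ i, HasSubgaussianMGF (Y i) (1 / 4) μ)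
    (t n : ℕ) (ht : 1 ≤ t) (hn : 1 ≤ n) :
    μ {ω | n * Real.sqrt (1.5 * Real.log t / n) ≤ ∑ k ∈ Finset.range n, Y k ω}
      ≤ ENNReal.ofReal (1 / (t : ℝ) ^ 3) := by
  have hn0 : (0 : ℝ) < n := by exact_mod_cast hn
  have ht0 : (0 : ℝ) < t := by exact_mod_cast ht
  have hl : 0 ≤ Real.log t := Real.log_nonneg (by exact_mod_cast ht)
  have h := HasSubgaussianMGF.measure_sum_range_ge_le_of_iIndepFun hindep (c := 1 / 4) (n := n)
    (fun i _ => hsub i) (ε := n * Real.sqrt (1.5 * Real.log t / n)) (by positivity)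
  have e : Real.exp (-(n * Real.sqrt (1.5 * Real.log t / n)) ^ 2
      / (2 * n * ((1 / 4 : NNReal) : ℝ))) = 1 / (t : ℝ) ^ 3 := by
    rw [mul_pow, Real.sq_sqrt (by positivity)]
    have : -((n : ℝ) ^ 2 * (1.5 * Real.log t / n)) / (2 * n * ((1 / 4 : NNReal) : ℝ))
        = - Real.log ((t : ℝ) ^ 3) := by
      rw [Real.log_pow]
      push_cast
      field_simp
      norm_num
      ring
    rw [this, Real.exp_neg, Real.exp_log (by positivity), one_div]
  rw [e] at h
  rw [← ofReal_measureReal]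
  exact ENNReal.ofReal_le_ofReal h

/-- Anytime Hoeffding confidence bound: for i.i.d. random variables with values in `[0,1]`
and mean `m`, the probability that for some sample size `n` with `1 ≤ n ≤ t` the empirical
mean deviates from `m` by at least `√(1.5 ln t / n)` is at most `2 / t²`. -/
theorem stmt3 {Ω : Type*} [MeasurableSpace Ω] (μ : Measure Ω) [IsProbabilityMeasure μ]
    (X : ℕ → Ω → ℝ) (hmeas : ∀ i, Measurable (X i))
    (hindep : iIndepFun X μ)
    (hident : ∀ i, IdentDistrib (X i) (X 0) μ μ)
    (hbdd : ∀ i, ∀ᵐ ω ∂μ, X i ω ∈ Set.Icc (0 : ℝ) 1)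
    (m : ℝ) (hm : ∫ ω, X 0 ω ∂μ = m)
    (t : ℕ) (ht : 1 ≤ t) :
    μ {ω | ∃ n : ℕ, 1 ≤ n ∧ n ≤ t ∧
        Real.sqrt (1.5 * Real.log t / n) ≤ |(∑ k ∈ Finset.range n, X k ω) / n - m|}
      ≤ ENNReal.ofReal (2 / (t : ℝ) ^ 2) := by
  have hn0 : (0 : ℝ) < t := by exact_mod_cast ht
  have hmean : ∀ i, ∫ ω, X i ω ∂μ = m := fun i => by rw [← hm]; exact (hident i).integral_eq
  have hsub : ∀ i, HasSubgaussianMGF (fun ω => X i ω - m) (1 / 4) μ := fun i => by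
    have h := hasSubgaussianMGF_of_mem_Icc (hmeas i).aemeasurable (hbdd i)
    rw [hmean i] at h
    convert h using 1
    norm_num
  have hsub' : ∀ i, HasSubgaussianMGF (fun ω => m - X i ω) (1 / 4) μ := fun i => by
    have h := (hsub i).neg
    convert h using 1
    ext ω
    simp
  have hi1 : iIndepFun (fun i ω => X i ω - m) μ :=
    hindep.comp (fun _ x => x - m) (fun _ => by fun_prop)
  have hi2 : iIndepFun (fun i ω => m - X i ω) μ :=
    hindep.comp (fun _ x => m - x) (fun _ => by fun_prop)
  have hsubset : {ω | ∃ n : ℕ, 1 ≤ n ∧ n ≤ t ∧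
        Real.sqrt (1.5 * Real.log t / n) ≤ |(∑ k ∈ Finset.range n, X k ω) / n - m|} ⊆
      ⋃ n ∈ Finset.Icc 1 t,
        ({ω | n * Real.sqrt (1.5 * Real.log t / n) ≤ ∑ k ∈ Finset.range n, (X k ω - m)} ∪
         {ω | n * Real.sqrt (1.5 * Real.log t / n) ≤ ∑ k ∈ Finset.range n, (m - X k ω)}) := by
    rintro ω ⟨n, h1, h2, h3⟩
    have hn : (0 : ℝ) < n := by exact_mod_cast h1
    simp only [Set.mem_iUnion]
    refine ⟨n, Finset.mem_Icc.2 ⟨h1, h2⟩, ?_⟩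
    have e : n * ((∑ k ∈ Finset.range n, X k ω) / n - m)
        = (∑ k ∈ Finset.range n, X k ω) - n * m := by field_simp
    simp only [Set.mem_union, Set.mem_setOf_eq, Finset.sum_sub_distrib, Finset.sum_const,
      Finset.card_range, nsmul_eq_mul]
    rcases le_abs.1 h3 with h | h
    · left
      rw [← e]
      exact mul_le_mul_of_nonneg_left h hn.le
    · right
      have := mul_le_mul_of_nonneg_left h hn.le
      linarith
  calc _ ≤ _ := measure_mono hsubset
    _ ≤ _ := measure_biUnion_finset_le _ _
    _ ≤ ∑ n ∈ Finset.Icc 1 t, ENNReal.ofReal (2 / (t : ℝ) ^ 3) := by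
      refine Finset.sum_le_sum fun n hn => ?_
      have h1 := (Finset.mem_Icc.1 hn).1
      refine (measure_union_le _ _).trans ((add_le_add
        (one_side_aux μ _ hi1 hsub t n ht h1) (one_side_aux μ _ hi2 hsub' t n ht h1)).trans ?_)
      rw [← ENNReal.ofReal_add (by positivity) (by positivity)]
      apply ENNReal.ofReal_le_ofReal
      apply le_of_eq
      ring
    _ = ENNReal.ofReal (2 / (t : ℝ) ^ 2) := by
      rw [← ENNReal.ofReal_sum_of_nonneg (fun _ _ => by positivity)]
      congr 1
      simp only [Finset.sum_const, Nat.card_Icc, nsmul_eq_mul, Nat.add_sub_cancel]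
      field_simp
end

section
/- Let J ≥ 1 and S ≥ 1 be integers, let ρ > 0 be a real number, and for each j ∈ {1, …, J} let T_j : {1, …, S} → ℝ be a nondecreasing sequence with T_j(1) ≥ 1. Assume that for every s with 1 ≤ s ≤ S − 1 there exists j ∈ {1, …, J} such that T_j(s+1) ≥ (1 + ρ) T_j(s). Then max_{1 ≤ j ≤ J} T_j(S) ≥ (1 + ρ)^{(S−1)/J}. -/
/-- Pigeonhole growth lemma: if each of the `J` nondecreasing sequences starts at least
at `1`, and at every step `1 ≤ s ≤ S − 1` at least one of them grows by a factor
`1 + ρ`, then after `S` steps the largest value is at least `(1 + ρ)^{(S−1)/J}`. -/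
theorem stmt10 (J S : ℕ) (hJ : 1 ≤ J) (hS : 1 ≤ S) (ρ : ℝ) (hρ : 0 < ρ)
    (T : ℕ → ℕ → ℝ)
    (hT1 : ∀ j, 1 ≤ j → j ≤ J → 1 ≤ T j 1)
    (hmono : ∀ j, 1 ≤ j → j ≤ J → ∀ s s', 1 ≤ s → s ≤ s' → s' ≤ S → T j s ≤ T j s')
    (hgrow : ∀ s, 1 ≤ s → s ≤ S - 1 → ∃ j, 1 ≤ j ∧ j ≤ J ∧ (1 + ρ) * T j s ≤ T j (s + 1)) :
    ∃ j, 1 ≤ j ∧ j ≤ J ∧ (1 + ρ) ^ (((S : ℝ) - 1) / J) ≤ T j S := by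
  have hpos : ∀ s, 1 ≤ s → s ≤ S → ∀ j ∈ Finset.Icc 1 J, 0 < T j s := by
    intro s h1 h2 j hj
    rw [Finset.mem_Icc] at hj
    have a := hT1 j hj.1 hj.2
    have b := hmono j hj.1 hj.2 1 s le_rfl h1 h2
    linarith
  have key : ∀ n : ℕ, n + 1 ≤ S → (1 + ρ) ^ n ≤ ∏ j ∈ Finset.Icc 1 J, T j (n + 1) := by
    intro n
    induction n with
    | zero =>
      intro _
      rw [pow_zero]
      refine Finset.one_le_prod ?_
      intro j hj
      rw [Finset.mem_Icc] at hj
      exact hT1 j hj.1 hj.2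
    | succ n ih =>
      intro hn
      have ih' := ih (by omega)
      obtain ⟨k, hk1, hk2, hk⟩ := hgrow (n + 1) (by omega) (by omega)
      have hkm : k ∈ Finset.Icc 1 J := Finset.mem_Icc.2 ⟨hk1, hk2⟩
      rw [← Finset.mul_prod_erase _ _ hkm] at ih' ⊢
      have hle : ∏ j ∈ (Finset.Icc 1 J).erase k, T j (n + 1)
          ≤ ∏ j ∈ (Finset.Icc 1 J).erase k, T j (n + 1 + 1) := by
        apply Finset.prod_le_prod
        · intro j hj
          exact (hpos (n + 1) (by omega) (by omega) j (Finset.mem_of_mem_erase hj)).le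
        · intro j hj
          have hj' := Finset.mem_Icc.1 (Finset.mem_of_mem_erase hj)
          exact hmono j hj'.1 hj'.2 _ _ (by omega) (by omega) hn
      have hp : 0 ≤ ∏ j ∈ (Finset.Icc 1 J).erase k, T j (n + 1) :=
        Finset.prod_nonneg fun j hj =>
          (hpos (n + 1) (by omega) (by omega) j (Finset.mem_of_mem_erase hj)).le
      have hk0 := hpos (n + 1 + 1) (by omega) hn k hkm
      calc (1 + ρ) ^ (n + 1) = (1 + ρ) * (1 + ρ) ^ n := by ring
        _ ≤ (1 + ρ) * (T k (n + 1) * ∏ j ∈ (Finset.Icc 1 J).erase k, T j (n + 1)) :=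
            mul_le_mul_of_nonneg_left ih' (by linarith)
        _ = ((1 + ρ) * T k (n + 1)) * ∏ j ∈ (Finset.Icc 1 J).erase k, T j (n + 1) := by ring
        _ ≤ _ := mul_le_mul hk hle hp hk0.le
  by_contra! hcon
  obtain ⟨n, rfl⟩ : ∃ n, S = n + 1 := ⟨S - 1, by omega⟩
  have h1 := key n le_rfl
  have h2 : ∏ j ∈ Finset.Icc 1 J, T j (n + 1)
      < ∏ j ∈ Finset.Icc 1 J, (1 + ρ) ^ ((((n + 1 : ℕ) : ℝ) - 1) / J) := by
    apply Finset.prod_lt_prod_of_nonempty (hpos (n + 1) hS le_rfl)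
    · intro j hj
      have hj' := Finset.mem_Icc.1 hj
      exact hcon j hj'.1 hj'.2
    · exact ⟨1, Finset.mem_Icc.2 ⟨le_rfl, hJ⟩⟩
  have hJ0 : (J : ℝ) ≠ 0 := by
    have : J ≠ 0 := by omega
    exact_mod_cast this
  rw [Finset.prod_const, Nat.card_Icc, Nat.add_sub_cancel, ← Real.rpow_natCast,
    ← Real.rpow_mul (by linarith), div_mul_cancel₀ _ hJ0] at h2
  push_cast at h2
  rw [add_sub_cancel_right, Real.rpow_natCast] at h2
  linarith
end

section
/- Let 0 < C_l ≤ C_u be real numbers and let c_1, c_2, … be i.i.d. random variables taking values in [C_l, C_u] almost surely, with mean c̄. For n ≥ 1 let S_n = ∑_{k=1}^n c_k and set S_0 = 0. Fix a real number l > 0 and define the random variable N = max{ n ≥ 0 : S_n ≤ l } (which is finite almost surely since c_k ≥ C_l > 0). Then E[N] ≥ l/c̄ − 1. -/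
open MeasureTheory ProbabilityTheory Finset

/-- Renewal-type lower bound (Wald): for i.i.d. completion times in `[C_l, C_u]` with mean
`c̄` and partial sums `S_n = ∑_{k=1}^n c_k`, the random count
`N = max{n ≥ 0 : S_n ≤ l}` (characterized a.s. by `S_N ≤ l < S_{N+1}`) satisfies
`E[N] ≥ l/c̄ − 1`. -/
theorem stmt13 {Ω : Type*} [MeasurableSpace Ω] (μ : Measure Ω) [IsProbabilityMeasure μ]
    (Cl Cu : ℝ) (hCl : 0 < Cl) (hCC : Cl ≤ Cu)
    (c : ℕ → Ω → ℝ) (hmeas : ∀ i, Measurable (c i))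
    (hindep : iIndepFun c μ)
    (hident : ∀ i, IdentDistrib (c i) (c 0) μ μ)
    (hbdd : ∀ i, ∀ᵐ ω ∂μ, c i ω ∈ Set.Icc Cl Cu)
    (cbar : ℝ) (hcbar : ∫ ω, c 0 ω ∂μ = cbar)
    (l : ℝ) (hl : 0 < l)
    (N : Ω → ℕ) (hNmeas : Measurable N)
    (hN : ∀ᵐ ω ∂μ, (∑ k ∈ Finset.range (N ω), c k ω) ≤ l ∧
      l < ∑ k ∈ Finset.range (N ω + 1), c k ω) :
    l / cbar - 1 ≤ ∫ ω, (N ω : ℝ) ∂μ := by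
  have hall : ∀ᵐ ω ∂μ, ∀ i, c i ω ∈ Set.Icc Cl Cu := ae_all_iff.2 hbdd
  set g : ℝ → ℝ := fun x => if x ≤ l then 1 else 0 with hg
  have hgm : Measurable g := Measurable.ite measurableSet_Iic measurable_const measurable_const
  set S : ℕ → Ω → ℝ := fun k ω => ∑ i ∈ Finset.range k, c i ω with hS
  have hSm : ∀ k, Measurable (S k) := fun k =>
    Finset.measurable_fun_sum _ (fun i _ => hmeas i)
  have hgS : ∀ k, Measurable (fun ω => g (S k ω)) := fun k => hgm.comp (hSm k)
  have hgb : ∀ x, |g x| ≤ 1 := by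
    intro x; simp only [hg]; split_ifs <;> simp
  have hIg : ∀ k, Integrable (fun ω => g (S k ω)) μ := fun k =>
    Integrable.of_bound (hgS k).aestronglyMeasurable 1 (Filter.Eventually.of_forall fun ω => hgb _)
  have hIc : ∀ k, Integrable (c k) μ := fun k =>
    Integrable.of_bound (hmeas k).aestronglyMeasurable Cu (by
      filter_upwards [hbdd k] with ω h
      rw [Real.norm_eq_abs, abs_of_nonneg (by linarith [h.1])]
      exact h.2)
  have hEc : ∀ k, ∫ ω, c k ω ∂μ = cbar := fun k => by rw [(hident k).integral_eq, hcbar]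
  have hcpos : 0 < cbar := by
    have h1 : ∫ ω, Cl ∂μ ≤ ∫ ω, c 0 ω ∂μ := by
      apply integral_mono_ae (integrable_const _) (hIc 0)
      filter_upwards [hbdd 0] with ω h using h.1
    simp at h1
    linarith
  have hInd : ∀ k, IndepFun (fun ω => g (S k ω)) (c k) μ := by
    intro k
    have h1 := hindep.indepFun_sum_range_succ hmeas k
    have h2 := h1.comp hgm measurable_id
    rw [Function.id_comp] at h2
    convert h2 using 1
    ext ω
    simp [hS]
  have hprod : ∀ k, ∫ ω, g (S k ω) * c k ω ∂μ = (∫ ω, g (S k ω) ∂μ) * cbar := by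
    intro k
    rw [← hEc k]
    exact (hInd k).integral_fun_mul_eq_mul_integral (hgS k).aestronglyMeasurable
      (hmeas k).aestronglyMeasurable
  have hIp : ∀ k, Integrable (fun ω => g (S k ω) * c k ω) μ := fun k =>
    (hInd k).integrable_mul (hIg k) (hIc k)
  obtain ⟨M, hM⟩ := exists_nat_gt (l / Cl)
  rw [div_lt_iff₀ hCl] at hM
  have key : ∀ᵐ ω ∂μ, N ω + 1 ≤ M ∧ ∀ k, g (S k ω) = if k < N ω + 1 then 1 else 0 := by
    filter_upwards [hall, hN] with ω hc hn
    have hmono : Monotone (fun k => S k ω) := by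
      apply monotone_nat_of_le_succ
      intro k
      simp only [hS, Finset.sum_range_succ]
      linarith [(hc k).1]
    constructor
    · have h1 : (N ω : ℝ) * Cl ≤ ∑ k ∈ Finset.range (N ω), c k ω := by
        have := Finset.card_nsmul_le_sum (Finset.range (N ω)) (fun k => c k ω) Cl
          (fun k _ => (hc k).1)
        simpa using this
      have h2 : (N ω : ℝ) < M := by
        refine lt_of_mul_lt_mul_right (a := Cl) ?_ hCl.le
        linarith [hn.1]
      exact_mod_cast h2
    · intro k
      by_cases hk : k < N ω + 1
      · have h3 : S k ω ≤ l := le_trans (hmono (Nat.lt_succ_iff.1 hk)) hn.1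
        simp [hg, h3, hk]
      · have h3 : ¬ S k ω ≤ l := not_le.2 (lt_of_lt_of_le hn.2 (hmono (not_lt.1 hk)))
        simp only [hg, if_neg h3, if_neg hk]
  have hfil : ∀ n, n ≤ M → (Finset.range M).filter (fun k => k < n) = Finset.range n := by
    intro n hn; ext k; simp; omega
  have e1 : ∀ᵐ ω ∂μ, ∑ k ∈ Finset.range M, g (S k ω) - 1 = (N ω : ℝ) := by
    filter_upwards [key] with ω ⟨h1, h2⟩
    simp only [h2]
    rw [← Finset.sum_filter, hfil _ h1]
    simp
  have e2 : ∀ᵐ ω ∂μ, l ≤ ∑ k ∈ Finset.range M, g (S k ω) * c k ω := by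
    filter_upwards [key, hN] with ω ⟨h1, h2⟩ h3
    simp only [h2, ite_mul, one_mul, zero_mul]
    rw [← Finset.sum_filter, hfil _ h1]
    exact h3.2.le
  have i1 : ∫ ω, (N ω : ℝ) ∂μ = ∑ k ∈ Finset.range M, ∫ ω, g (S k ω) ∂μ - 1 := by
    rw [← integral_congr_ae e1, integral_sub (integrable_finsetSum _ fun k _ => hIg k)
      (integrable_const _), integral_finsetSum _ fun k _ => hIg k]
    simp
  have i2 : l ≤ (∑ k ∈ Finset.range M, ∫ ω, g (S k ω) ∂μ) * cbar := by
    have h := integral_mono_ae (integrable_const l)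
      (integrable_finsetSum (Finset.range M) fun k _ => hIp k) e2
    rw [integral_finsetSum _ fun k _ => hIp k] at h
    simp only [hprod] at h
    rw [Finset.sum_mul]
    simpa using h
  rw [i1]
  have := (div_le_iff₀ hcpos).2 i2
  linarith
end

section
/- Let I be a finite set, let α ≥ 0 be a real number, and let q, q̂, d : I → ℝ be functions satisfying q_i ≤ q̂_i ≤ q_i + d_i for all i ∈ I. Let A*, Â, A' be subsets of I such that ∑_{i ∈ Â} q̂_i ≥ ∑_{i ∈ A*} q̂_i and (1 + α) ∑_{i ∈ A'} q̂_i ≥ ∑_{i ∈ Â} q̂_i. Then (1/(1+α)) ∑_{i ∈ A*} q_i − ∑_{i ∈ A'} q_i ≤ ∑_{i ∈ A'} d_i. -/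
open Finset

/-- Approximate-oracle sub-optimality bound: if `q_i ≤ q̂_i ≤ q_i + d_i` on `I`, the
assignment `Â` dominates the benchmark `A*` under the UCB index `q̂`, and `A'` is a
`(1+α)`-approximate maximizer relative to `Â`, then the `α`-sub-optimality gap of `A'`
is bounded by the sum of the confidence radii over `A'`. -/
theorem stmt16 {ι : Type*} (I : Finset ι) (α : ℝ) (hα : 0 ≤ α)
    (q qhat d : ι → ℝ) (hq : ∀ i ∈ I, q i ≤ qhat i ∧ qhat i ≤ q i + d i)
    (Astar Ahat A' : Finset ι) (hAstar : Astar ⊆ I) (hAhat : Ahat ⊆ I) (hA' : A' ⊆ I)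
    (h1 : ∑ i ∈ Astar, qhat i ≤ ∑ i ∈ Ahat, qhat i)
    (h2 : ∑ i ∈ Ahat, qhat i ≤ (1 + α) * ∑ i ∈ A', qhat i) :
    (1 / (1 + α)) * ∑ i ∈ Astar, q i - ∑ i ∈ A', q i ≤ ∑ i ∈ A', d i := by
  have a1 : ∑ i ∈ Astar, q i ≤ ∑ i ∈ Astar, qhat i :=
    Finset.sum_le_sum fun i hi => (hq i (hAstar hi)).1
  have a2 : ∑ i ∈ A', qhat i ≤ ∑ i ∈ A', q i + ∑ i ∈ A', d i := by
    rw [← Finset.sum_add_distrib]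
    exact Finset.sum_le_sum fun i hi => (hq i (hA' hi)).2
  have hpos : 0 < 1 + α := by linarith
  have a3 : (1 / (1 + α)) * ∑ i ∈ Astar, q i ≤ ∑ i ∈ A', qhat i := by
    rw [one_div, inv_mul_le_iff₀ hpos]
    linarith
  linarith
end

section
/- Let I be a finite set and let q, q̂, d : I → ℝ be functions satisfying q_i ≤ q̂_i ≤ q_i + d_i for all i ∈ I. Let A*, A' be subsets of I such that ∑_{i ∈ A'} q̂_i ≥ ∑_{i ∈ A*} q̂_i. Then ∑_{i ∈ A*} q_i − ∑_{i ∈ A'} q_i ≤ ∑_{i ∈ A' \ A*} d_i. -/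
open Finset

/-- Exact-oracle sub-optimality bound: if `q_i ≤ q̂_i ≤ q_i + d_i` on `I` and the
assignment `A'` dominates the benchmark `A*` under the UCB index `q̂`, then the
sub-optimality gap of `A'` is bounded by the sum of the confidence radii over
`A' \ A*`. -/
theorem stmt17 {ι : Type*} [DecidableEq ι] (I : Finset ι)
    (q qhat d : ι → ℝ) (hq : ∀ i ∈ I, q i ≤ qhat i ∧ qhat i ≤ q i + d i)
    (Astar A' : Finset ι) (hAstar : Astar ⊆ I) (hA' : A' ⊆ I)
    (h1 : ∑ i ∈ Astar, qhat i ≤ ∑ i ∈ A', qhat i) :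
    ∑ i ∈ Astar, q i - ∑ i ∈ A', q i ≤ ∑ i ∈ A' \ Astar, d i := by
  have e1 := Finset.sum_sdiff_sub_sum_sdiff (s₁ := Astar) (s₂ := A') (f := q)
  have e2 := Finset.sum_sdiff_sub_sum_sdiff (s₁ := Astar) (s₂ := A') (f := qhat)
  have b1 : ∑ i ∈ Astar \ A', q i ≤ ∑ i ∈ Astar \ A', qhat i :=
    Finset.sum_le_sum fun i hi => (hq i (hAstar (Finset.mem_sdiff.1 hi).1)).1
  have b2 : ∑ i ∈ A' \ Astar, qhat i ≤ ∑ i ∈ A' \ Astar, (q i + d i) :=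
    Finset.sum_le_sum fun i hi => (hq i (hA' (Finset.mem_sdiff.1 hi).1)).2
  rw [Finset.sum_add_distrib] at b2
  linarith
end
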